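/- arXiv:math/0209377 — 7 statements merged into one kernel-verified Lean document; each statement's English description precedes it below -/
import Mathlib

section
/- Let Δ : ℝ → ℝ be differentiable with Δ(x) > 0 for all x, and let f : ℝ → ℝ be continuously differentiable. Then for every x ∈ ℝ the top-hat filter f̄ is differentiable at x and satisfies the exact identity f̄′(x) = overline{f′}(x) − (Δ′(x)/Δ(x)) · f̄(x) + (Δ′(x)/(2Δ(x))) · [ f(x + Δ(x)/2) + f(x − Δ(x)/2) ]. -/
open MeasureTheory intervalIntegral

/-- Exact identity for the derivative of the top-hat filter with variable
filter width. -/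
theorem tophat_filter_deriv (Δ f : ℝ → ℝ)
    (hΔ : Differentiable ℝ Δ) (hΔpos : ∀ x, 0 < Δ x)
    (hf : ContDiff ℝ 1 f) (x : ℝ) :
    HasDerivAt
      (fun x => (1 / Δ x) * ∫ s in (x - Δ x / 2)..(x + Δ x / 2), f s)
      ((1 / Δ x) * (∫ s in (x - Δ x / 2)..(x + Δ x / 2), deriv f s)
        - (deriv Δ x / Δ x) *
            ((1 / Δ x) * ∫ s in (x - Δ x / 2)..(x + Δ x / 2), f s)
        + (deriv Δ x / (2 * Δ x)) * (f (x + Δ x / 2) + f (x - Δ x / 2))) x := by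
  have hc : Continuous f := hf.continuous
  have hD : HasDerivAt Δ (deriv Δ x) x := (hΔ x).hasDerivAt
  have hne : Δ x ≠ 0 := (hΔpos x).ne'
  have hF : ∀ u, HasDerivAt (fun v => ∫ s in (0:ℝ)..v, f s) (f u) u := fun u =>
    intervalIntegral.integral_hasDerivAt_right (hc.intervalIntegrable _ _)
      hc.stronglyMeasurable.stronglyMeasurableAtFilter hc.continuousAt
  have hp : HasDerivAt (fun y => y + Δ y / 2) (1 + deriv Δ x / 2) x :=
    (hasDerivAt_id' x).add (hD.div_const 2)
  have hm : HasDerivAt (fun y => y - Δ y / 2) (1 - deriv Δ x / 2) x :=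
    (hasDerivAt_id' x).sub (hD.div_const 2)
  have hI : HasDerivAt (fun y => ∫ s in (y - Δ y / 2)..(y + Δ y / 2), f s)
      (f (x + Δ x / 2) * (1 + deriv Δ x / 2) - f (x - Δ x / 2) * (1 - deriv Δ x / 2)) x := by
    have h1 := (HasDerivAt.comp x (hF (x + Δ x / 2)) hp).sub
      (HasDerivAt.comp x (hF (x - Δ x / 2)) hm)
    refine h1.congr_of_eventuallyEq (Filter.Eventually.of_forall fun y => ?_)
    exact (intervalIntegral.integral_interval_sub_left (hc.intervalIntegrable _ _)
      (hc.intervalIntegrable _ _)).symm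
  have hFTC : ∫ s in (x - Δ x / 2)..(x + Δ x / 2), deriv f s
      = f (x + Δ x / 2) - f (x - Δ x / 2) :=
    intervalIntegral.integral_deriv_eq_sub
      (fun y _ => (hf.differentiable (by norm_num)) y)
      ((hf.continuous_deriv le_rfl).intervalIntegrable _ _)
  have hinv : HasDerivAt (fun y => 1 / Δ y) (-deriv Δ x / Δ x ^ 2) x := by
    simpa only [one_div] using hD.fun_inv hne
  rw [hFTC]
  refine (hinv.mul hI).congr_deriv ?_
  field_simp
  ring
end

section
/- Let Δ : ℝ → ℝ be differentiable with Δ(x) > 0 for all x, and let f : ℝ → ℝ be twice continuously differentiable. Then for every x ∈ ℝ, the error in interchanging differentiation and top-hat filtering satisfies | f̄′(x) − overline{f′}(x) | ≤ (1/12) · |Δ′(x)| · Δ(x) · sup_{s ∈ [x−Δ(x)/2, x+Δ(x)/2]} |f″(s)|. -/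
open MeasureTheory intervalIntegral

lemma trap_aux (f : ℝ → ℝ) (hf : ContDiff ℝ 2 f) (a b : ℝ) (hab : a < b) :
    |(b - a) / 2 * (f a + f b) - ∫ s in a..b, f s| ≤
      (b - a) ^ 3 * sSup ((fun s => |iteratedDeriv 2 f s|) '' Set.Icc a b) / 12 := by
  have hcont : Continuous (iteratedDeriv 2 f) := hf.continuous_iteratedDeriv 2 le_rfl
  have hbdd : BddAbove ((fun s => |iteratedDeriv 2 f s|) '' Set.Icc a b) :=
    (isCompact_Icc.image hcont.abs).bddAbove
  have hu : UniqueDiffOn ℝ (Set.Icc a b) := uniqueDiffOn_Icc hab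
  have key := trapezoidal_error_le (f := f) (a := a) (b := b)
    (ζ := sSup ((fun s => |iteratedDeriv 2 f s|) '' Set.Icc a b)) (N := 1)
    (hf.differentiable (by norm_num)).differentiableOn
    (by
      rw [Set.uIcc_of_lt hab]
      have h1 : ContDiffOn ℝ 1 (derivWithin f (Set.Icc a b)) (Set.Icc a b) :=
        hf.contDiffOn.derivWithin hu (by norm_num)
      exact h1.differentiableOn (by norm_num))
    (by
      intro y
      rw [Set.uIcc_of_lt hab]
      by_cases hy : y ∈ Set.Icc a b
      · rw [iteratedDerivWithin_eq_iteratedDeriv hu hf.contDiffAt hy]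
        exact le_csSup hbdd ⟨y, hy, rfl⟩
      · rw [iteratedDerivWithin_succ, derivWithin_zero_of_notMem_closure
          (by rwa [isClosed_Icc.closure_eq]), abs_zero]
        refine (abs_nonneg _).trans
          (le_csSup hbdd ⟨a, Set.left_mem_Icc.2 hab.le, rfl⟩))
    one_pos
  rw [trapezoidal_error, trapezoidal_integral_one, abs_of_pos (sub_pos.2 hab)] at key
  simpa using key

/-- Bound on the error in interchanging differentiation and top-hat filtering. -/
theorem tophat_interchange_error (Δ f : ℝ → ℝ)
    (hΔ : Differentiable ℝ Δ) (hΔpos : ∀ x, 0 < Δ x)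
    (hf : ContDiff ℝ 2 f) (x : ℝ) :
    |deriv (fun x => (1 / Δ x) * ∫ s in (x - Δ x / 2)..(x + Δ x / 2), f s) x
      - (1 / Δ x) * ∫ s in (x - Δ x / 2)..(x + Δ x / 2), deriv f s| ≤
    (1 / 12) * |deriv Δ x| * Δ x *
      sSup ((fun s => |iteratedDeriv 2 f s|) ''
        Set.Icc (x - Δ x / 2) (x + Δ x / 2)) := by
  have hp := hΔpos x
  have hc : Continuous f := hf.continuous
  have hF : ∀ u, HasDerivAt (fun u => ∫ s in (0:ℝ)..u, f s) (f u) u := fun u =>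
    hc.integral_hasStrictDerivAt 0 u |>.hasDerivAt
  have hsplit : (fun x => (1 / Δ x) * ∫ s in (x - Δ x / 2)..(x + Δ x / 2), f s) =
      fun x => (Δ x)⁻¹ * ((∫ s in (0:ℝ)..(x + Δ x / 2), f s)
        - ∫ s in (0:ℝ)..(x - Δ x / 2), f s) := by
    funext y
    rw [integral_interval_sub_left (hc.intervalIntegrable _ _) (hc.intervalIntegrable _ _),
      one_div]
  have hD := (hΔ x).hasDerivAt
  have hb : HasDerivAt (fun x => x + Δ x / 2) (1 + deriv Δ x / 2) x :=
    (hasDerivAt_id x).add (hD.div_const 2)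
  have ha : HasDerivAt (fun x => x - Δ x / 2) (1 - deriv Δ x / 2) x :=
    (hasDerivAt_id x).sub (hD.div_const 2)
  have hB := (hF (x + Δ x / 2)).comp x hb
  have hA := (hF (x - Δ x / 2)).comp x ha
  have hder := ((hD.inv hp.ne').mul (hB.sub hA)).deriv
  have hd1 : (∫ s in (x - Δ x / 2)..(x + Δ x / 2), deriv f s)
      = f (x + Δ x / 2) - f (x - Δ x / 2) :=
    integral_deriv_eq_sub (fun y _ => hf.differentiable (by norm_num) y)
      ((hf.continuous_deriv (by norm_num)).intervalIntegrable _ _)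
  have hT := trap_aux f hf (x - Δ x / 2) (x + Δ x / 2) (by linarith)
  have hI : (∫ s in (x - Δ x / 2)..(x + Δ x / 2), f s) =
      (∫ s in (0:ℝ)..(x + Δ x / 2), f s) - ∫ s in (0:ℝ)..(x - Δ x / 2), f s :=
    (integral_interval_sub_left (hc.intervalIntegrable _ _) (hc.intervalIntegrable _ _)).symm
  rw [hI] at hT
  rw [hsplit, hd1]
  erw [hder]
  simp only [Function.comp, Pi.sub_apply, Pi.inv_apply]
  generalize sSup ((fun s => |iteratedDeriv 2 f s|) '' Set.Icc (x - Δ x / 2) (x + Δ x / 2)) = M at *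
  generalize (∫ s in (0:ℝ)..(x + Δ x / 2), f s) = P at *
  generalize (∫ s in (0:ℝ)..(x - Δ x / 2), f s) = Q at *
  have e : x + Δ x / 2 - (x - Δ x / 2) = Δ x := by ring
  rw [e] at hT
  generalize f (x + Δ x / 2) = fb at *
  generalize f (x - Δ x / 2) = fa at *
  have heq : -deriv Δ x / Δ x ^ 2 * (P - Q) +
      (Δ x)⁻¹ * (fb * (1 + deriv Δ x / 2) - fa * (1 - deriv Δ x / 2)) - 1 / Δ x * (fb - fa)
      = deriv Δ x / Δ x ^ 2 * (Δ x / 2 * (fa + fb) - (P - Q)) := by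
    field_simp
    ring
  rw [heq, abs_mul, abs_div, abs_of_pos (pow_pos hp 2)]
  calc _ ≤ |deriv Δ x| / Δ x ^ 2 * (Δ x ^ 3 * M / 12) := by gcongr
    _ = _ := by field_simp
end

section
/- Let Δ : ℝ → ℝ be differentiable with Δ(x) > 0 for all x, and suppose there is a constant K ≥ 0 with |Δ′(x)| ≤ K · Δ(x) for all x (i.e., the filter width has exponential-type grading). Then for every twice continuously differentiable f : ℝ → ℝ and every x ∈ ℝ, the interchange error is second order in the filter width: | f̄′(x) − overline{f′}(x) | ≤ (K/12) · Δ(x)² · sup_{s ∈ [x−Δ(x)/2, x+Δ(x)/2]} |f″(s)|. -/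
open MeasureTheory intervalIntegral

/-- With exponential-type grading of the filter width, the interchange error
is second order in the filter width. -/
theorem tophat_interchange_error_second_order (Δ : ℝ → ℝ) (K : ℝ)
    (hΔ : Differentiable ℝ Δ) (hΔpos : ∀ x, 0 < Δ x)
    (hK : 0 ≤ K) (hgrad : ∀ x, |deriv Δ x| ≤ K * Δ x)
    (f : ℝ → ℝ) (hf : ContDiff ℝ 2 f) (x : ℝ) :
    |deriv (fun x => (1 / Δ x) * ∫ s in (x - Δ x / 2)..(x + Δ x / 2), f s) x
      - (1 / Δ x) * ∫ s in (x - Δ x / 2)..(x + Δ x / 2), deriv f s| ≤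
    (K / 12) * (Δ x) ^ 2 *
      sSup ((fun s => |iteratedDeriv 2 f s|) ''
        Set.Icc (x - Δ x / 2) (x + Δ x / 2)) := by
  have hD := hΔpos x
  have hΔx := (hΔ x).hasDerivAt
  have hfc : Continuous f := hf.continuous
  have hfd : Differentiable ℝ f := hf.differentiable (by norm_num)
  have hf'c : Continuous (deriv f) := hf.continuous_deriv (by norm_num)
  have hf2c : Continuous (iteratedDeriv 2 f) := hf.continuous_iteratedDeriv 2 le_rfl
  set M := sSup ((fun s => |iteratedDeriv 2 f s|) ''
        Set.Icc (x - Δ x / 2) (x + Δ x / 2)) with hM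
  have hbdd : BddAbove ((fun s => |iteratedDeriv 2 f s|) ''
        Set.Icc (x - Δ x / 2) (x + Δ x / 2)) :=
    (isCompact_Icc.image hf2c.abs).bddAbove
  have hMle : ∀ s ∈ Set.Icc (x - Δ x / 2) (x + Δ x / 2), |iteratedDeriv 2 f s| ≤ M :=
    fun s hs => le_csSup hbdd ⟨s, hs, rfl⟩
  have hlt : x - Δ x / 2 < x + Δ x / 2 := by linarith
  have hM0 : 0 ≤ M := (abs_nonneg _).trans (hMle (x - Δ x / 2) ⟨le_rfl, hlt.le⟩)
  have htrap : |trapezoidal_error f 1 (x - Δ x / 2) (x + Δ x / 2)| ≤ (Δ x) ^ 3 * M / 12 := by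
    have h := trapezoidal_error_le_of_c2 (f := f) (a := x - Δ x / 2) (b := x + Δ x / 2)
      hf.contDiffOn (ζ := M) (fun s => ?_) (N := 1) one_pos
    · have e : x + Δ x / 2 - (x - Δ x / 2) = Δ x := by ring
      rw [e, abs_of_pos hD] at h
      simpa using h
    · rw [Set.uIcc_of_lt hlt]
      by_cases hs : s ∈ Set.Icc (x - Δ x / 2) (x + Δ x / 2)
      · rw [iteratedDerivWithin_eq_iteratedDeriv (uniqueDiffOn_Icc hlt) hf.contDiffAt hs]
        exact hMle s hs
      · rw [iteratedDerivWithin_succ, derivWithin_zero_of_notMem_closure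
          (by rwa [isClosed_Icc.closure_eq])]
        simpa using hM0
  have hF : ∀ u, HasDerivAt (fun t => ∫ s in (0:ℝ)..t, f s) (f u) u := fun u =>
    hfc.integral_hasStrictDerivAt 0 u |>.hasDerivAt
  have hsplit : ∀ a b : ℝ, ∫ s in a..b, f s = (∫ s in (0:ℝ)..b, f s) - ∫ s in (0:ℝ)..a, f s :=
    fun a b => (integral_interval_sub_left (hfc.intervalIntegrable _ _)
      (hfc.intervalIntegrable _ _)).symm
  have hb : HasDerivAt (fun y => ∫ s in (0:ℝ)..(y + Δ y / 2), f s)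
      (f (x + Δ x / 2) * (1 + deriv Δ x / 2)) x :=
    HasDerivAt.comp (h₂ := fun t => ∫ s in (0:ℝ)..t, f s) (h := fun y => y + Δ y / 2) x
      (hF (x + Δ x / 2)) ((hasDerivAt_id' x).fun_add (hΔx.div_const 2))
  have ha : HasDerivAt (fun y => ∫ s in (0:ℝ)..(y - Δ y / 2), f s)
      (f (x - Δ x / 2) * (1 - deriv Δ x / 2)) x :=
    HasDerivAt.comp (h₂ := fun t => ∫ s in (0:ℝ)..t, f s) (h := fun y => y - Δ y / 2) x
      (hF (x - Δ x / 2)) ((hasDerivAt_id' x).fun_sub (hΔx.div_const 2))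
  have hI : HasDerivAt (fun y => ∫ s in (y - Δ y / 2)..(y + Δ y / 2), f s)
      (f (x + Δ x / 2) * (1 + deriv Δ x / 2) - f (x - Δ x / 2) * (1 - deriv Δ x / 2)) x := by
    have := hb.fun_sub ha
    simpa only [← hsplit] using this
  have hinv : HasDerivAt (fun y => 1 / Δ y) (-deriv Δ x / (Δ x) ^ 2) x := by
    simpa only [one_div] using hΔx.fun_inv hD.ne'
  rw [(hinv.fun_mul hI).deriv, integral_deriv_eq_sub (fun y _ => hfd y)
    (hf'c.intervalIntegrable _ _)]
  have key : ∀ I : ℝ, -deriv Δ x / (Δ x) ^ 2 * I + 1 / Δ x *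
      (f (x + Δ x / 2) * (1 + deriv Δ x / 2) - f (x - Δ x / 2) * (1 - deriv Δ x / 2))
      - 1 / Δ x * (f (x + Δ x / 2) - f (x - Δ x / 2))
      = deriv Δ x / (Δ x) ^ 2 * (Δ x / 2 * (f (x - Δ x / 2) + f (x + Δ x / 2)) - I) := by
    intro I
    field_simp
    ring
  have e : x + Δ x / 2 - (x - Δ x / 2) = Δ x := by ring
  rw [trapezoidal_error, trapezoidal_integral_one, e] at htrap
  rw [key, abs_mul, abs_div, abs_of_pos (pow_pos hD 2)]
  calc _ ≤ (K * Δ x) / (Δ x) ^ 2 * ((Δ x) ^ 3 * M / 12) := by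
        gcongr
        exact hgrad x
    _ = _ := by
        field_simp
end

section
/- Let G : ℝ → ℝ be integrable on [−1/2, 1/2], let Δ : ℝ → ℝ be differentiable with Δ(x) > 0 for all x, and let u : ℝ → ℝ be continuously differentiable. Then ū is differentiable and for every x ∈ ℝ, ū′(x) − overline{u′}(x) = −Δ′(x) · ∫_{−1/2}^{1/2} y · G(y) · u′(x − y Δ(x)) dy. -/
open MeasureTheory intervalIntegral

/-- Exact formula for the filter/derivative interchange error for a general
kernel filter with variable filter width. -/
theorem kernel_filter_interchange (G Δ u : ℝ → ℝ)
    (hG : IntegrableOn G (Set.Icc (-(1/2) : ℝ) (1/2)))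
    (hΔ : Differentiable ℝ Δ) (hΔpos : ∀ x, 0 < Δ x)
    (hu : ContDiff ℝ 1 u) (x : ℝ) :
    HasDerivAt
      (fun x => ∫ y in (-(1/2) : ℝ)..(1/2), G y * u (x - y * Δ x))
      ((∫ y in (-(1/2) : ℝ)..(1/2), G y * deriv u (x - y * Δ x))
        - deriv Δ x * ∫ y in (-(1/2) : ℝ)..(1/2),
            y * G y * deriv u (x - y * Δ x)) x := by
  have hGi : IntervalIntegrable G volume (-(1/2) : ℝ) (1/2) := by
    rw [intervalIntegrable_iff_integrableOn_Icc_of_le (by norm_num)]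
    exact hG
  have hu' : Continuous (deriv u) := hu.continuous_deriv le_rfl
  have huc : Continuous u := hu.continuous
  have hud : Differentiable ℝ u := hu.differentiable one_ne_zero
  have hGm : AEStronglyMeasurable G (volume.restrict (Set.uIoc (-(1/2) : ℝ) (1/2))) :=
    hGi.def'.aestronglyMeasurable
  set R : ℝ := |x| + 1 + (|Δ x| + 1) with hR
  obtain ⟨C, hC⟩ := (isCompact_Icc (a := -R) (b := R)).exists_bound_of_continuousOn
    hu'.continuousOn
  have hR0 : 0 ≤ R := by positivity
  have hC0 : 0 ≤ C := (norm_nonneg _).trans (hC 0 ⟨by linarith, hR0⟩)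
  let L : ℝ → (ℝ × ℝ →L[ℝ] ℝ) := fun y =>
    ContinuousLinearMap.fst ℝ ℝ ℝ - y • ContinuousLinearMap.snd ℝ ℝ ℝ
  have hL : Continuous L := by fun_prop
  let F : ℝ × ℝ → ℝ → ℝ := fun p y => G y * u (p.1 - y * p.2)
  let F' : ℝ × ℝ → ℝ → (ℝ × ℝ →L[ℝ] ℝ) := fun p y =>
    G y • (deriv u (p.1 - y * p.2) • L y)
  have hF'i : IntervalIntegrable (F' (x, Δ x)) volume (-(1/2) : ℝ) (1/2) := by
    apply hGi.smul_continuousOn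
    apply Continuous.continuousOn
    fun_prop
  have key : HasFDerivAt (fun p => ∫ y in (-(1/2) : ℝ)..(1/2), F p y)
      (∫ y in (-(1/2) : ℝ)..(1/2), F' (x, Δ x) y) (x, Δ x) := by
    refine hasFDerivAt_integral_of_dominated_of_fderiv_le (bound := fun y => ‖G y‖ * (C * 2))
      (Metric.ball_mem_nhds (x, Δ x) one_pos) ?_ ?_ ?_ ?_ ?_ ?_
    · refine Filter.Eventually.of_forall fun p => ?_
      refine hGm.mul (Continuous.aestronglyMeasurable ?_)
      fun_prop
    · apply hGi.mul_continuousOn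
      apply Continuous.continuousOn
      fun_prop
    · exact hF'i.def'.aestronglyMeasurable
    · refine Filter.Eventually.of_forall fun y hy p hp => ?_
      rw [Set.uIoc_of_le (by norm_num)] at hy
      have hy1 : |y| ≤ 1 := abs_le.2 ⟨by linarith [hy.1], by linarith [hy.2]⟩
      rw [Metric.mem_ball, Prod.dist_eq, max_lt_iff, Real.dist_eq, Real.dist_eq] at hp
      have h1 : |p.1| ≤ |x| + 1 := by
        have := abs_sub_abs_le_abs_sub p.1 x
        have := hp.1
        simp only at this
        linarith
      have h2 : |p.2| ≤ |Δ x| + 1 := by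
        have := abs_sub_abs_le_abs_sub p.2 (Δ x)
        have := hp.2
        simp only at this
        linarith
      have h3 : |p.1 - y * p.2| ≤ R := by
        have h4 := abs_sub p.1 (y * p.2)
        have h5 : |y * p.2| ≤ |p.2| := by
          rw [abs_mul]
          exact mul_le_of_le_one_left (abs_nonneg _) hy1
        linarith
      have h6 := hC _ (abs_le.1 h3)
      have h7 : ‖L y‖ ≤ 2 := by
        refine (norm_sub_le _ _).trans ?_
        rw [norm_smul, Real.norm_eq_abs]
        have a1 := ContinuousLinearMap.norm_fst_le ℝ ℝ ℝ
        have a2 := ContinuousLinearMap.norm_snd_le ℝ ℝ ℝ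
        have := mul_le_one₀ hy1 (norm_nonneg _) a2
        linarith
      simp only [F', norm_smul]
      gcongr
    · exact hGi.norm.mul_const _
    · refine Filter.Eventually.of_forall fun y hy p hp => ?_
      have hLd : HasFDerivAt (fun p : ℝ × ℝ => p.1 - y * p.2) (L y) p :=
        hasFDerivAt_fst.sub (hasFDerivAt_snd.const_mul y)
      exact ((hud _).hasDerivAt.comp_hasFDerivAt p hLd).const_mul (G y)
  have hc : HasDerivAt (fun z => (z, Δ z)) ((1 : ℝ), deriv Δ x) x :=
    (hasDerivAt_id x).prodMk (hΔ x).hasDerivAt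
  have h := HasFDerivAt.comp_hasDerivAt (f := fun z => (z, Δ z)) x key hc
  rw [ContinuousLinearMap.intervalIntegral_apply hF'i] at h
  refine h.congr_deriv ?_
  rw [← intervalIntegral.integral_const_mul, ← intervalIntegral.integral_sub]
  · congr 1
    ext y
    simp [F', L]
    ring
  · apply hGi.mul_continuousOn
    apply Continuous.continuousOn
    fun_prop
  · apply IntervalIntegrable.const_mul
    apply IntervalIntegrable.mul_continuousOn
    · exact hGi.continuousOn_mul continuous_id.continuousOn
    · apply Continuous.continuousOn
      fun_prop
end

section
/- Let G : ℝ → ℝ be integrable on [−1/2, 1/2], even (G(−y) = G(y)), and let Δ : ℝ → ℝ be differentiable with Δ(x) > 0 for all x. Fix x₀ ∈ ℝ and let u : ℝ → ℝ be continuous and piecewise linear with two pieces: u(s) = α₁ + β₁ s for s ≤ x₀ and u(s) = α₂ + β₂ s for s ≥ x₀ (with α₁ + β₁ x₀ = α₂ + β₂ x₀). Then ū is differentiable at x₀ and ū′(x₀) − overline{u′}(x₀) = (β₂ − β₁) · Δ′(x₀) · ∫_{0}^{1/2} y · G(y) dy, where overline{u′} is computed from the almost-everywhere derivative u′(s) =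 β₁ for s < x₀ and u′(s) = β₂ for s > x₀. -/
open MeasureTheory intervalIntegral

/-- Interchange error for a continuous piecewise linear (two-piece) finite
element function filtered by an even kernel. -/
theorem piecewise_linear_interchange (G Δ : ℝ → ℝ)
    (hG : IntegrableOn G (Set.Icc (-(1/2) : ℝ) (1/2)))
    (hGeven : ∀ y, G (-y) = G y)
    (hΔ : Differentiable ℝ Δ) (hΔpos : ∀ x, 0 < Δ x)
    (x₀ α₁ β₁ α₂ β₂ : ℝ) (u : ℝ → ℝ)
    (hu₁ : ∀ s, s ≤ x₀ → u s = α₁ + β₁ * s)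
    (hu₂ : ∀ s, x₀ ≤ s → u s = α₂ + β₂ * s)
    (hcont : α₁ + β₁ * x₀ = α₂ + β₂ * x₀) :
    HasDerivAt
      (fun x => ∫ y in (-(1/2) : ℝ)..(1/2), G y * u (x - y * Δ x))
      ((∫ y in (-(1/2) : ℝ)..(1/2),
          G y * (if x₀ - y * Δ x₀ < x₀ then β₁ else β₂))
        + (β₂ - β₁) * deriv Δ x₀ * ∫ y in (0 : ℝ)..(1/2), y * G y) x₀ := by
  have hu : u = fun s => α₁ + β₁ * s + (β₂ - β₁) * max (s - x₀) 0 := by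
    funext s
    rcases le_total s x₀ with h | h
    · rw [hu₁ s h, max_eq_right (by linarith)]; ring
    · rw [hu₂ s h, max_eq_left (by linarith)]; linarith
  have hucont : Continuous u := by rw [hu]; fun_prop
  have hulip : ∀ s t, |u s - u t| ≤ (|β₁| + |β₂ - β₁|) * |s - t| := by
    intro s t
    have h1 : u s - u t = β₁ * (s - t) + (β₂ - β₁) * (max (s - x₀) 0 - max (t - x₀) 0) := by
      rw [hu]; ring
    have h2 : |max (s - x₀) 0 - max (t - x₀) 0| ≤ |s - t| := by
      have := abs_max_sub_max_le_abs (s - x₀) (t - x₀) 0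
      simpa using this
    rw [h1]
    refine (abs_add_le _ _).trans ?_
    rw [abs_mul, abs_mul, add_mul]
    gcongr
  set D := deriv Δ x₀ with hD
  have hΔd : HasDerivAt Δ D x₀ := (hΔ x₀).hasDerivAt
  obtain ⟨C, hC⟩ := hΔd.isBigO_sub.bound
  set b : ℝ → ℝ := fun y => if x₀ - y * Δ x₀ < x₀ then β₁ else β₂ with hb
  have hbm : Measurable b := by
    refine Measurable.ite ?_ measurable_const measurable_const
    exact measurableSet_lt (by fun_prop) (by fun_prop)
  have hbb : ∀ y, |b y| ≤ |β₁| + |β₂| := by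
    intro y
    simp only [hb]
    split_ifs
    · linarith [abs_nonneg β₂]
    · linarith [abs_nonneg β₁]
  have hle : (-(1/2) : ℝ) ≤ 1/2 := by norm_num
  have hGI : IntervalIntegrable G volume (-(1/2)) (1/2) :=
    (intervalIntegrable_iff_integrableOn_Icc_of_le hle).2 hG
  have hGb : IntervalIntegrable (fun y => G y * b y) volume (-(1/2)) (1/2) := by
    rw [intervalIntegrable_iff_integrableOn_Ioc_of_le hle] at hGI ⊢
    exact Integrable.mul_bdd (c := |β₁| + |β₂|) hGI hbm.aestronglyMeasurable
      (Filter.Eventually.of_forall hbb)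
  have hyGb : IntervalIntegrable (fun y => y * (G y * b y)) volume (-(1/2)) (1/2) :=
    hGb.continuousOn_mul continuousOn_id
  have hderiv : ∀ y, y ≠ 0 →
      HasDerivAt (fun x => G y * u (x - y * Δ x)) (G y * (b y * (1 - y * D))) x₀ := by
    intro y hy
    have hin : HasDerivAt (fun x => x - y * Δ x) (1 - y * D) x₀ :=
      (hasDerivAt_id x₀).sub (hΔd.const_mul y)
    have hud : HasDerivAt u (b y) (x₀ - y * Δ x₀) := by
      by_cases h : x₀ - y * Δ x₀ < x₀
      · have : b y = β₁ := if_pos h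
        rw [this]
        have h1 : HasDerivAt (fun s => α₁ + β₁ * s) β₁ (x₀ - y * Δ x₀) := by
          simpa using ((hasDerivAt_id (x₀ - y * Δ x₀)).const_mul β₁).const_add α₁
        refine h1.congr_of_eventuallyEq ?_
        filter_upwards [Iio_mem_nhds h] with s hs using hu₁ s (le_of_lt hs)
      · have : b y = β₂ := if_neg h
        rw [this]
        have h' : x₀ < x₀ - y * Δ x₀ := by
          refine lt_of_le_of_ne (not_lt.1 h) ?_
          intro h0
          have : y * Δ x₀ = 0 := by linarith
          exact (mul_ne_zero hy (hΔpos x₀).ne') this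
        have h1 : HasDerivAt (fun s => α₂ + β₂ * s) β₂ (x₀ - y * Δ x₀) := by
          simpa using ((hasDerivAt_id (x₀ - y * Δ x₀)).const_mul β₂).const_add α₂
        refine h1.congr_of_eventuallyEq ?_
        filter_upwards [Ioi_mem_nhds h'] with s hs using hu₂ s (le_of_lt hs)
    exact (hud.comp x₀ hin).const_mul (G y)
  have hgI : IntervalIntegrable (fun y => G y * (b y * (1 - y * D))) volume (-(1/2)) (1/2) := by
    have := hGb.sub (hyGb.const_mul D)
    refine this.congr ?_
    intro y _
    simp only []
    ring
  have hFI : ∀ x, IntervalIntegrable (fun y => G y * u (x - y * Δ x)) volume (-(1/2)) (1/2) := by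
    intro x
    exact hGI.mul_continuousOn (by fun_prop)
  -- the value
  have hval : (∫ y in (-(1/2) : ℝ)..(1/2), G y * (b y * (1 - y * D))) =
      (∫ y in (-(1/2) : ℝ)..(1/2), G y * b y)
        + (β₂ - β₁) * D * ∫ y in (0 : ℝ)..(1/2), y * G y := by
    have e1 : (∫ y in (-(1/2) : ℝ)..(1/2), G y * (b y * (1 - y * D))) =
        (∫ y in (-(1/2) : ℝ)..(1/2), G y * b y)
          - D * ∫ y in (-(1/2) : ℝ)..(1/2), y * (G y * b y) := by
      rw [← intervalIntegral.integral_const_mul, ← intervalIntegral.integral_sub hGb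
        (hyGb.const_mul D)]
      congr 1; funext y; ring
    have s1 : IntervalIntegrable (fun y => y * (G y * b y)) volume (-(1/2)) 0 :=
      hyGb.mono_set (by rw [Set.uIcc_of_le (by norm_num), Set.uIcc_of_le hle]; exact Set.Icc_subset_Icc le_rfl (by norm_num))
    have s2 : IntervalIntegrable (fun y => y * (G y * b y)) volume 0 (1/2) :=
      hyGb.mono_set (by rw [Set.uIcc_of_le (by norm_num), Set.uIcc_of_le hle]; exact Set.Icc_subset_Icc (by norm_num) le_rfl)
    have e2 : (∫ y in (-(1/2) : ℝ)..0, y * (G y * b y)) = β₂ * ∫ y in (-(1/2) : ℝ)..0, y * G y := by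
      rw [← intervalIntegral.integral_const_mul]
      apply intervalIntegral.integral_congr
      intro y hy
      rw [Set.uIcc_of_le (by norm_num)] at hy
      have : b y = β₂ := if_neg (by nlinarith [hy.2, hΔpos x₀])
      simp only [this]; ring
    have e3 : (∫ y in (0 : ℝ)..(1/2), y * (G y * b y)) = β₁ * ∫ y in (0 : ℝ)..(1/2), y * G y := by
      rw [← intervalIntegral.integral_const_mul]
      apply intervalIntegral.integral_congr
      intro y hy
      rw [Set.uIcc_of_le (by norm_num)] at hy
      rcases hy.1.eq_or_lt with h | h
      · simp [← h]
      · have : b y = β₁ := if_pos (by nlinarith [mul_pos h (hΔpos x₀)])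
        simp only [this]; ring
    have e4 : (∫ y in (-(1/2) : ℝ)..0, y * G y) = - ∫ y in (0 : ℝ)..(1/2), y * G y := by
      have := intervalIntegral.integral_comp_neg (a := (0:ℝ)) (b := 1/2) (fun y => y * G y)
      rw [neg_zero] at this
      rw [← this, ← intervalIntegral.integral_neg]
      congr 1; funext y; rw [hGeven]; ring
    rw [e1, ← intervalIntegral.integral_add_adjacent_intervals s1 s2, e2, e3, e4]
    ring
  rw [← hval]
  simp only [intervalIntegral.integral_of_le hle]
  have hgI' := hgI.1
  have hne : ∀ᵐ y ∂(volume.restrict (Set.Ioc (-(1/2) : ℝ) (1/2))), y ≠ 0 :=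
    ae_restrict_of_ae (Measure.ae_ne volume 0)
  have hmem : ∀ᵐ y ∂(volume.restrict (Set.Ioc (-(1/2) : ℝ) (1/2))), y ∈ Set.Ioc (-(1/2) : ℝ) (1/2) :=
    ae_restrict_mem measurableSet_Ioc
  set L : ℝ →L[ℝ] ℝ →L[ℝ] ℝ := ContinuousLinearMap.smulRightL ℝ ℝ ℝ 1
  have key := hasFDerivAt_integral_of_dominated_loc_of_lip' (𝕜 := ℝ)
    (μ := volume.restrict (Set.Ioc (-(1/2) : ℝ) (1/2)))
    (F := fun x y => G y * u (x - y * Δ x)) (x₀ := x₀)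
    (F' := fun y => L (G y * (b y * (1 - y * D))))
    (bound := fun y => ‖G y‖ * ((|β₁| + |β₂ - β₁|) * (1 + |C|)))
    hC (fun x _ => (hFI x).1.aestronglyMeasurable) (hFI x₀).1
    (L.continuous.comp_aestronglyMeasurable hgI'.aestronglyMeasurable)
    ?_ (hGI.1.norm.mul_const _) ?_
  · have h2 := key.2
    have h3 : (∫ y in Set.Ioc (-(1/2) : ℝ) (1/2), L (G y * (b y * (1 - y * D)))) =
      L (∫ y in Set.Ioc (-(1/2) : ℝ) (1/2), (G y * (b y * (1 - y * D)))) :=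
      L.integral_comp_comm hgI'
    rw [h3] at h2
    have h4 := h2.hasDerivAt
    simpa [L] using h4
  · filter_upwards [hmem] with y hy x hx
    have hx' : |Δ x - Δ x₀| ≤ C * |x - x₀| := hx
    have hy' : |y| ≤ 1 := abs_le.2 ⟨by linarith [hy.1], by linarith [hy.2]⟩
    rw [← mul_sub, norm_mul, mul_assoc]
    refine mul_le_mul_of_nonneg_left ?_ (norm_nonneg _)
    refine (hulip _ _).trans ?_
    rw [mul_assoc]
    refine mul_le_mul_of_nonneg_left ?_ (by positivity)
    have e : x - y * Δ x - (x₀ - y * Δ x₀) = (x - x₀) - y * (Δ x - Δ x₀) := by ring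
    rw [e, Real.norm_eq_abs]
    refine (abs_sub _ _).trans ?_
    rw [abs_mul]
    have h5 : |y| * |Δ x - Δ x₀| ≤ 1 * (|C| * |x - x₀|) := by
      refine mul_le_mul hy' (hx'.trans ?_) (abs_nonneg _) zero_le_one
      exact mul_le_mul_of_nonneg_right (le_abs_self C) (abs_nonneg _)
    linarith
  · filter_upwards [hne] with y hy
    exact (hderiv y hy).hasFDerivAt
end

section
/- Let G : ℝ → ℝ be nonnegative, even, integrable, and vanishing outside [−1/2, 1/2]; let Δ : ℝ → ℝ be differentiable with Δ(x) > 0 for all x. Fix x₀ ∈ ℝ and let u : ℝ → ℝ be continuous, equal on (−∞, x₀] to a twice continuously differentiable function f₁ and on [x₀, ∞) to a twice continuously differentiable function f₂, with |f₁″| ≤ M and |f₂″| ≤ M on [x₀ − Δ(x₀)/2, x₀ + Δ(x₀)/2]. Then | ū′(x₀) − overline{u′}(x₀) | ≤ |Δ′(x₀)| · [ |f₂′(x₀) − f₁′(x₀)| · ∫_{0}^{1/2} y G(y) dy + Δ(x₀) · M · ∫_{−1/2}^{1/2} y² G(y) dy ], where overline{u′} is computed from the almost-everywhere derivative of u. 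-/
open MeasureTheory intervalIntegral

lemma aux_lip (x₀ : ℝ) (u f₁ f₂ : ℝ → ℝ) 
    (hf₁ : ContDiff ℝ 2 f₁) (hf₂ : ContDiff ℝ 2 f₂)
    (hu₁ : ∀ s, s ≤ x₀ → u s = f₁ s)
    (hu₂ : ∀ s, x₀ ≤ s → u s = f₂ s) : LocallyLipschitz u := by
  have h1 : LocallyLipschitz f₁ := (hf₁.of_le (by norm_num)).locallyLipschitz
  have h2 : LocallyLipschitz f₂ := (hf₂.of_le (by norm_num)).locallyLipschitz
  have h3 : u = fun s => f₁ (min s x₀) + f₂ (max s x₀) - f₁ x₀ := by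
    funext s
    rcases le_total s x₀ with h | h
    · simp only [min_eq_left h, max_eq_right h, hu₁ s h, ← hu₁ x₀ le_rfl, ← hu₂ x₀ le_rfl]
      ring
    · simp only [min_eq_right h, max_eq_left h, hu₂ s h]
      ring
  rw [h3]
  have e1 : LocallyLipschitz (fun s : ℝ => min s x₀) := LocallyLipschitz.id.min_const x₀
  have e2 : LocallyLipschitz (fun s : ℝ => max s x₀) := LocallyLipschitz.id.max_const x₀
  exact ((h1.comp e1).add (h2.comp e2)).sub (LocallyLipschitz.const _)

lemma aux_deriv (G Δ D : ℝ → ℝ) (hGint : Integrable G) (hΔ : Differentiable ℝ Δ)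
    (hΔpos : ∀ x, 0 < Δ x) (x₀ : ℝ) (u : ℝ → ℝ) (hu : LocallyLipschitz u)
    (hDm : Measurable D)
    (hD : ∀ y, y ≠ 0 → HasDerivAt u (D y) (x₀ - y * Δ x₀)) :
    HasDerivAt (fun x => ∫ y in (-(1/2) : ℝ)..(1/2), G y * u (x - y * Δ x))
      (∫ y in (-(1/2) : ℝ)..(1/2), G y * (D y * (1 - y * deriv Δ x₀))) x₀ := by
  have huc := hu.continuous
  simp only [intervalIntegral.integral_of_le (show (-(1/2) : ℝ) ≤ 1/2 by norm_num)]
  obtain ⟨C, hC⟩ := (hΔ x₀).isBigO_sub.bound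
  have hball : ∀ᶠ x in nhds x₀, |x - x₀| < 1 := by
    have := Metric.ball_mem_nhds x₀ one_pos
    filter_upwards [this] with x hx
    simpa [Real.dist_eq] using hx
  set C' := max C 0 with hC'
  have hC0 : 0 ≤ C' := le_max_right _ _
  set R := 1 + (Δ x₀ + C') / 2 with hR
  obtain ⟨K, hK⟩ := (hu.locallyLipschitzOn (s := Metric.closedBall x₀ R)).exists_lipschitzOnWith_of_compact
    (isCompact_closedBall x₀ R)
  have hs := hC.and hball
  have key := hasFDerivAt_integral_of_dominated_loc_of_lip' (𝕜 := ℝ) (x₀ := x₀)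
    (μ := volume.restrict (Set.Ioc (-(1/2) : ℝ) (1/2)))
    (F := fun x y => G y * u (x - y * Δ x))
    (F' := fun y => ContinuousLinearMap.toSpanSingleton ℝ (G y * (D y * (1 - y * deriv Δ x₀))))
    (bound := fun y => |G y| * (K * (1 + C' / 2))) hs ?_ ?_ ?_ ?_ ?_ ?_
  · have h2 := key.2.hasDerivAt
    rw [ContinuousLinearMap.integral_apply key.1] at h2
    simpa using h2
  · intro x _
    exact hGint.aestronglyMeasurable.restrict.mul
      (by fun_prop : Continuous fun y => u (x - y * Δ x)).aestronglyMeasurable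
  · have : IntervalIntegrable (fun y => G y * u (x₀ - y * Δ x₀)) volume (-(1/2)) (1/2) :=
      hGint.intervalIntegrable.mul_continuousOn (by fun_prop)
    exact (intervalIntegrable_iff_integrableOn_Ioc_of_le (by norm_num)).1 this
  · have : AEStronglyMeasurable (fun y => G y * (D y * (1 - y * deriv Δ x₀))) 
        (volume.restrict (Set.Ioc (-(1/2) : ℝ) (1/2))) :=
      hGint.aestronglyMeasurable.restrict.mul
        (by fun_prop : Measurable fun y => (D y * (1 - y * deriv Δ x₀))).aestronglyMeasurable
    exact (ContinuousLinearMap.toSpanSingletonCLE (𝕜 := ℝ) (E := ℝ)).continuous.comp_aestronglyMeasurable this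
  · filter_upwards [ae_restrict_mem measurableSet_Ioc] with y hy x hx
    obtain ⟨hx1, hx2⟩ := hx
    simp only [Real.norm_eq_abs] at hx1 ⊢
    have hyy : |y| ≤ 1/2 := abs_le.2 ⟨hy.1.le, hy.2⟩
    have hx3 : |Δ x - Δ x₀| ≤ C' * |x - x₀| := hx1.trans (by gcongr; exact le_max_left _ _)
    have hd : |(x - y * Δ x) - (x₀ - y * Δ x₀)| ≤ (1 + C'/2) * |x - x₀| := by
      have : (x - y * Δ x) - (x₀ - y * Δ x₀) = (x - x₀) - y * (Δ x - Δ x₀) := by ring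
      rw [this]
      calc _ ≤ |x - x₀| + |y * (Δ x - Δ x₀)| := abs_sub _ _
        _ = |x - x₀| + |y| * |Δ x - Δ x₀| := by rw [abs_mul]
        _ ≤ |x - x₀| + 1/2 * (C' * |x - x₀|) := by gcongr
        _ = _ := by ring
    have hb0 : |(x₀ - y * Δ x₀) - x₀| ≤ Δ x₀ / 2 := by
      have : (x₀ - y * Δ x₀) - x₀ = -(y * Δ x₀) := by ring
      rw [this, abs_neg, abs_mul, abs_of_pos (hΔpos x₀)]
      nlinarith [hΔpos x₀]
    have hm0 : x₀ - y * Δ x₀ ∈ Metric.closedBall x₀ R := by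
      rw [Metric.mem_closedBall, Real.dist_eq]; linarith
    have hm1 : x - y * Δ x ∈ Metric.closedBall x₀ R := by
      rw [Metric.mem_closedBall, Real.dist_eq]
      have := abs_sub_le (x - y * Δ x) (x₀ - y * Δ x₀) x₀
      nlinarith
    have := hK.dist_le_mul _ hm1 _ hm0
    rw [Real.dist_eq, Real.dist_eq] at this
    rw [← mul_sub, abs_mul, mul_assoc, mul_assoc]
    gcongr
    exact this.trans (by gcongr)
  · exact (hGint.abs.mul_const _).restrict
  · have h0 : ∀ᵐ y : ℝ, y ≠ 0 := by simp [ae_iff]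
    filter_upwards [ae_restrict_of_ae h0] with y hy
    have hin : HasDerivAt (fun x => x - y * Δ x) (1 - y * deriv Δ x₀) x₀ :=
      (hasDerivAt_id x₀).sub ((hΔ x₀).hasDerivAt.const_mul y)
    have := ((hD y hy).comp x₀ hin).const_mul (G y)
    exact this.hasFDerivAt

lemma aux_mvt (f : ℝ → ℝ) (hf : ContDiff ℝ 2 f) (a b M x y : ℝ)
    (hM : ∀ s ∈ Set.Icc a b, |iteratedDeriv 2 f s| ≤ M) (hx : x ∈ Set.Icc a b)
    (hy : y ∈ Set.Icc a b) : |deriv f y - deriv f x| ≤ M * |y - x| := by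
  have e : iteratedDeriv 2 f = deriv (deriv f) := by
    rw [iteratedDeriv_succ, iteratedDeriv_one]
  rw [e] at hM
  have hd : Differentiable ℝ (deriv f) := by
    have := hf.differentiable_iteratedDeriv 1 (by norm_num)
    rwa [iteratedDeriv_one] at this
  exact (convex_Icc a b).norm_image_sub_le_of_norm_deriv_le (fun z _ => hd z) hM hx hy



/-- Interchange error bound for a continuous piecewise-C² function filtered by
a nonnegative even compactly supported kernel. -/
theorem piecewise_C2_interchange_bound (G Δ : ℝ → ℝ)
    (hGpos : ∀ y, 0 ≤ G y) (hGeven : ∀ y, G (-y) = G y)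
    (hGint : Integrable G)
    (hGsupp : ∀ y, y ∉ Set.Icc (-(1/2) : ℝ) (1/2) → G y = 0)
    (hΔ : Differentiable ℝ Δ) (hΔpos : ∀ x, 0 < Δ x)
    (x₀ M : ℝ) (u f₁ f₂ : ℝ → ℝ) (hu_cont : Continuous u)
    (hf₁ : ContDiff ℝ 2 f₁) (hf₂ : ContDiff ℝ 2 f₂)
    (hu₁ : ∀ s, s ≤ x₀ → u s = f₁ s)
    (hu₂ : ∀ s, x₀ ≤ s → u s = f₂ s)
    (hM₁ : ∀ s ∈ Set.Icc (x₀ - Δ x₀ / 2) (x₀ + Δ x₀ / 2),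
        |iteratedDeriv 2 f₁ s| ≤ M)
    (hM₂ : ∀ s ∈ Set.Icc (x₀ - Δ x₀ / 2) (x₀ + Δ x₀ / 2),
        |iteratedDeriv 2 f₂ s| ≤ M) :
    |deriv (fun x => ∫ y in (-(1/2) : ℝ)..(1/2), G y * u (x - y * Δ x)) x₀
      - ∫ y in (-(1/2) : ℝ)..(1/2),
          G y * (if x₀ - y * Δ x₀ < x₀ then deriv f₁ (x₀ - y * Δ x₀)
                 else deriv f₂ (x₀ - y * Δ x₀))| ≤
    |deriv Δ x₀| *
      (|deriv f₂ x₀ - deriv f₁ x₀| * (∫ y in (0 : ℝ)..(1/2), y * G y)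
        + Δ x₀ * M * ∫ y in (-(1/2) : ℝ)..(1/2), y ^ 2 * G y) := by
  have hd0 := hΔpos x₀
  have hc1 : Continuous (deriv f₁) := hf₁.continuous_deriv (by norm_num)
  have hc2 : Continuous (deriv f₂) := hf₂.continuous_deriv (by norm_num)
  set D : ℝ → ℝ := fun y => if x₀ - y * Δ x₀ < x₀ then deriv f₁ (x₀ - y * Δ x₀)
                 else deriv f₂ (x₀ - y * Δ x₀) with hDdef
  have hDp : ∀ y, 0 < y → D y = deriv f₁ (x₀ - y * Δ x₀) := fun y hy =>
    if_pos (by nlinarith [mul_pos hy hd0])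
  have hDn : ∀ y, y ≤ 0 → D y = deriv f₂ (x₀ - y * Δ x₀) := fun y hy =>
    if_neg (by nlinarith [mul_nonneg (neg_nonneg.2 hy) hd0.le])
  have hDm : Measurable D := Measurable.ite
    (measurableSet_lt (by fun_prop) (by fun_prop)) (by fun_prop) (by fun_prop)
  have hD : ∀ y, y ≠ 0 → HasDerivAt u (D y) (x₀ - y * Δ x₀) := by
    intro y hy
    rcases lt_or_gt_of_ne hy with h | h
    · rw [hDn y h.le]
      have hlt : x₀ < x₀ - y * Δ x₀ := by nlinarith [mul_pos (neg_pos.2 h) hd0]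
      refine ((hf₂.differentiable (by norm_num)) _).hasDerivAt.congr_of_eventuallyEq ?_
      filter_upwards [lt_mem_nhds hlt] with s hs using hu₂ s hs.le
    · rw [hDp y h]
      have hlt : x₀ - y * Δ x₀ < x₀ := by nlinarith [mul_pos h hd0]
      refine ((hf₁.differentiable (by norm_num)) _).hasDerivAt.congr_of_eventuallyEq ?_
      filter_upwards [gt_mem_nhds hlt] with s hs using hu₁ s hs.le
  rw [(aux_deriv G Δ D hGint hΔ hΔpos x₀ u (aux_lip x₀ u f₁ f₂ hf₁ hf₂ hu₁ hu₂) hDm hD).deriv]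
  have hGI : ∀ (a b : ℝ) (g : ℝ → ℝ), Continuous g →
      IntervalIntegrable (fun y => G y * g y) volume a b := fun a b g hg =>
    hGint.intervalIntegrable.mul_continuousOn hg.continuousOn
  have hGD : ∀ g : ℝ → ℝ, Continuous g →
      IntervalIntegrable (fun y => G y * (D y * g y)) volume (-(1/2)) 0 ∧
      IntervalIntegrable (fun y => G y * (D y * g y)) volume 0 (1/2) := by
    intro g hg
    constructor
    · refine (hGI (-(1/2)) 0 (fun y => deriv f₂ (x₀ - y * Δ x₀) * g y) (by fun_prop)).congr_uIoo ?_
      intro y hy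
      rw [Set.uIoo_of_le (by norm_num)] at hy
      simp only [hDn y hy.2.le]
    · refine (hGI 0 (1/2) (fun y => deriv f₁ (x₀ - y * Δ x₀) * g y) (by fun_prop)).congr_uIoo ?_
      intro y hy
      rw [Set.uIoo_of_le (by norm_num)] at hy
      simp only [hDp y hy.1]
  have hi1 := (hGD (fun y => 1 - y * deriv Δ x₀) (by fun_prop))
  have hi2 : IntervalIntegrable (fun y => G y * D y) volume (-(1/2)) (1/2) := by
    have := hGD (fun _ => 1) (by fun_prop)
    simpa using this.1.trans this.2
  have hi3 := hGD (fun y => y) (by fun_prop)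
  rw [← intervalIntegral.integral_sub (hi1.1.trans hi1.2) hi2]
  have e1 : (∫ y in (-(1/2) : ℝ)..(1/2), (G y * (D y * (1 - y * deriv Δ x₀)) - G y * D y))
      = -deriv Δ x₀ * ∫ y in (-(1/2) : ℝ)..(1/2), G y * (D y * y) := by
    rw [← intervalIntegral.integral_const_mul]
    congr 1; funext y; ring
  rw [e1, abs_mul, abs_neg]
  refine mul_le_mul_of_nonneg_left ?_ (abs_nonneg _)
  rw [← intervalIntegral.integral_add_adjacent_intervals hi3.1 hi3.2]
  have e2 : (∫ y in (-(1/2) : ℝ)..0, G y * (D y * y))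
      = ∫ y in (0 : ℝ)..(1/2), G y * (deriv f₂ (x₀ + y * Δ x₀) * (-y)) := by
    have := intervalIntegral.integral_comp_neg (a := 0) (b := 1/2) (fun y => G y * (D y * y))
    rw [neg_zero] at this
    rw [← this]
    apply intervalIntegral.integral_congr_Ioo_of_le (by norm_num)
    intro y hy
    simp only [hGeven, hDn (-y) (by linarith [hy.1])]
    ring_nf
  have e3 : (∫ y in (0 : ℝ)..(1/2), G y * (D y * y))
      = ∫ y in (0 : ℝ)..(1/2), G y * (deriv f₁ (x₀ - y * Δ x₀) * y) := by
    apply intervalIntegral.integral_congr_Ioo_of_le (by norm_num)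
    intro y hy
    simp only [hDp y hy.1]
  have hj : ∀ a b : ℝ, IntervalIntegrable (fun y => y ^ 2 * G y) volume a b := by
    intro a b
    simpa [mul_comm] using hGI a b (fun y => y ^ 2) (by fun_prop)
  have hj1 : IntervalIntegrable (fun y => y * G y) volume 0 (1/2) := by
    simpa [mul_comm] using hGI 0 (1/2) (fun y => y) (by fun_prop)
  have e4 : (∫ y in (-(1/2) : ℝ)..(1/2), y ^ 2 * G y) = 
      2 * ∫ y in (0 : ℝ)..(1/2), y ^ 2 * G y := by
    rw [← intervalIntegral.integral_add_adjacent_intervals (hj _ 0) (hj 0 _)]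
    have := intervalIntegral.integral_comp_neg (a := 0) (b := 1/2) (fun y => y ^ 2 * G y)
    rw [neg_zero] at this
    rw [← this]
    simp only [hGeven, neg_sq]
    ring
  have k1 := hGI 0 (1/2) (fun y => deriv f₂ (x₀ + y * Δ x₀) * (-y)) (by fun_prop)
  have k2 := hGI 0 (1/2) (fun y => deriv f₁ (x₀ - y * Δ x₀) * y) (by fun_prop)
  rw [e2, e3, e4, ← intervalIntegral.integral_add k1 k2]
  refine (intervalIntegral.abs_integral_le_integral_abs (by norm_num)).trans ?_
  have e5 : |deriv f₂ x₀ - deriv f₁ x₀| * (∫ y in (0 : ℝ)..(1/2), y * G y)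
        + Δ x₀ * M * (2 * ∫ y in (0 : ℝ)..(1/2), y ^ 2 * G y)
      = ∫ y in (0 : ℝ)..(1/2), (|deriv f₂ x₀ - deriv f₁ x₀| * (y * G y)
        + (Δ x₀ * M * 2) * (y ^ 2 * G y)) := by
    rw [intervalIntegral.integral_add (hj1.const_mul _) ((hj _ _).const_mul _),
      intervalIntegral.integral_const_mul, intervalIntegral.integral_const_mul]
    ring
  rw [e5]
  refine intervalIntegral.integral_mono_on (by norm_num) (k1.add k2).abs
    ((hj1.const_mul _).add ((hj _ _).const_mul _)) ?_
  intro y hy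
  have hy0 := hy.1
  have hyd : 0 ≤ y * Δ x₀ := by positivity
  have hyd2 : y * Δ x₀ ≤ Δ x₀ / 2 := by nlinarith [hy.2]
  have m1 := aux_mvt f₁ hf₁ _ _ M x₀ (x₀ - y * Δ x₀) hM₁ ⟨by linarith, by linarith⟩
    ⟨by linarith, by linarith⟩
  have m2 := aux_mvt f₂ hf₂ _ _ M x₀ (x₀ + y * Δ x₀) hM₂ ⟨by linarith, by linarith⟩
    ⟨by linarith, by linarith⟩
  rw [show x₀ - y * Δ x₀ - x₀ = -(y * Δ x₀) by ring, abs_neg, abs_of_nonneg hyd] at m1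
  rw [show x₀ + y * Δ x₀ - x₀ = y * Δ x₀ by ring, abs_of_nonneg hyd] at m2
  have e6 : G y * (deriv f₂ (x₀ + y * Δ x₀) * (-y)) + G y * (deriv f₁ (x₀ - y * Δ x₀) * y)
      = (y * G y) * (deriv f₁ (x₀ - y * Δ x₀) - deriv f₂ (x₀ + y * Δ x₀)) := by ring
  have hyG : 0 ≤ y * G y := mul_nonneg hy0 (hGpos y)
  rw [e6, abs_mul, abs_of_nonneg hyG]
  have e7 : |deriv f₁ (x₀ - y * Δ x₀) - deriv f₂ (x₀ + y * Δ x₀)|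
      ≤ |deriv f₂ x₀ - deriv f₁ x₀| + 2 * (M * (y * Δ x₀)) := by
    have a0 := abs_le.1 (le_refl |deriv f₂ x₀ - deriv f₁ x₀|)
    have a1 := abs_le.1 m1
    have a2 := abs_le.1 m2
    rw [abs_le]
    constructor <;> linarith [a0.1, a0.2, a1.1, a1.2, a2.1, a2.2]
  calc _ ≤ (y * G y) * (|deriv f₂ x₀ - deriv f₁ x₀| + 2 * (M * (y * Δ x₀))) := by gcongr
    _ = _ := by ring
end

section
/- Let G : ℝ → ℝ be nonnegative, even, integrable, and vanishing outside [−1/2, 1/2]; let Δ : ℝ → ℝ be differentiable with Δ(x) > 0 for all x. Let u : ℝ → ℝ be twice continuously differentiable with |u″| ≤ M_u everywhere. Fix x₀ ∈ ℝ and element widths Δ₁, Δ₂ > 0 with Δ(x₀) ≤ 2 · min(Δ₁, Δ₂). Let u_e : ℝ → ℝ be continuous, equal on (−∞, x₀] to a twice continuously differentiable function f₁ and on [x₀, ∞) to a twice continuously differentiable function f₂, satisfying the nodal interpolation conditions f₁(x₀ − Δ₁) = u(x₀ − Δ₁), f₁(x₀) = u(x₀) = f₂(x₀), f₂(x₀ +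 Δ₂) = u(x₀ + Δ₂), and with |f₁″| ≤ M on [x₀ − Δ₁, x₀] and |f₂″| ≤ M on [x₀, x₀ + Δ₂]. Then the error in interchanging filtering and differentiation applied to u_e satisfies | ū_e′(x₀) − overline{u_e′}(x₀) | ≤ |Δ′(x₀)| · [ ((Δ₁ + Δ₂)/2) · (M_u + M) · ∫_{0}^{1/2} y G(y) dy + Δ(x₀) · M · ∫_{−1/2}^{1/2} y² G(y) dy ]; in particular the interchange error is of order O(Δ_e(x₀) · Δ′(x₀)) in the local element width Δ_e = max(Δ₁, Δ₂). -/
open MeasureTheory intervalIntegral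

theorem fem_aux_deriv_lip (f : ℝ → ℝ) (hf : ContDiff ℝ 2 f) (a b M : ℝ)
    (hM : ∀ s ∈ Set.Icc a b, |iteratedDeriv 2 f s| ≤ M) (s t : ℝ)
    (hs : s ∈ Set.Icc a b) (ht : t ∈ Set.Icc a b) :
    |deriv f s - deriv f t| ≤ M * |s - t| := by
  have hd : ContDiff ℝ 1 (deriv f) := by
    have h2 : ContDiff ℝ (1 + 1) f := by simpa [one_add_one_eq_two] using hf
    exact (contDiff_succ_iff_deriv.1 h2).2.2
  have hdd : Differentiable ℝ (deriv f) := hd.differentiable (by norm_num)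
  refine Convex.norm_image_sub_le_of_norm_hasDerivWithin_le (f := deriv f)
    (f' := fun x => iteratedDeriv 2 f x) ?_ ?_ (convex_Icc a b) ht hs
  · intro x _
    have := (hdd x).hasDerivAt
    rw [iteratedDeriv_succ, iteratedDeriv_one]
    exact this.hasDerivWithinAt
  · intro x hx
    exact hM x hx

theorem fem_aux_slope_le (k k' : ℝ → ℝ) (h K : ℝ) (hh : 0 < h)
    (hk : ∀ t, HasDerivAt k (k' t) t) (hK : ∀ t ∈ Set.Icc 0 h, |k' t - k' 0| ≤ K * t)
    (h0 : k 0 = 0) (h1 : k h = 0) : k' 0 ≤ h / 2 * K := by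
  have hd : ∀ t, HasDerivAt (fun t => k t - k' 0 * t + K / 2 * t ^ 2)
      (k' t - k' 0 + K * t) t := by
    intro t
    have := ((hk t).sub ((hasDerivAt_id t).const_mul (k' 0))).add
      (((hasDerivAt_id t).pow 2).const_mul (K / 2))
    exact this.congr_deriv (by simp; ring)
  have hmono : MonotoneOn (fun t => k t - k' 0 * t + K / 2 * t ^ 2) (Set.Icc 0 h) := by
    refine monotoneOn_of_deriv_nonneg (convex_Icc _ _)
      (fun t _ => (hd t).continuousAt.continuousWithinAt)
      (fun t _ => (hd t).differentiableAt.differentiableWithinAt) ?_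
    intro t ht
    rw [interior_Icc] at ht
    rw [(hd t).deriv]
    have := (abs_le.1 (hK t ⟨ht.1.le, ht.2.le⟩)).1
    linarith
  have := hmono (Set.left_mem_Icc.2 hh.le) (Set.right_mem_Icc.2 hh.le) hh.le
  simp only [h0, h1] at this
  have h3 : 0 ≤ h * (h / 2 * K - k' 0) := by nlinarith
  have := nonneg_of_mul_nonneg_right h3 hh
  linarith

theorem fem_aux_slope (k k' : ℝ → ℝ) (h K : ℝ) (hh : 0 < h)
    (hk : ∀ t, HasDerivAt k (k' t) t) (hK : ∀ t ∈ Set.Icc 0 h, |k' t - k' 0| ≤ K * t)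
    (h0 : k 0 = 0) (h1 : k h = 0) : |k' 0| ≤ h / 2 * K := by
  refine abs_le'.2 ⟨fem_aux_slope_le k k' h K hh hk hK h0 h1, ?_⟩
  refine fem_aux_slope_le (fun t => - k t) (fun t => - k' t) h K hh (fun t => (hk t).neg) ?_
    (by simp [h0]) (by simp [h1])
  intro t ht
  have := hK t ht
  rw [← abs_neg] at this
  convert this using 2
  ring

/-- Node slope comparison, in direction `σ = ±1`. -/
theorem fem_aux_node (f u : ℝ → ℝ) (hf : ContDiff ℝ 2 f) (hu : ContDiff ℝ 2 u)
    (x₀ h σ M Mu : ℝ) (hσ : |σ| = 1) (hh : 0 < h)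
    (h0 : f x₀ = u x₀) (h1 : f (x₀ + σ * h) = u (x₀ + σ * h))
    (hM : ∀ t ∈ Set.Icc 0 h, |deriv f (x₀ + σ * t) - deriv f x₀| ≤ M * t)
    (hMu : ∀ t ∈ Set.Icc 0 h, |deriv u (x₀ + σ * t) - deriv u x₀| ≤ Mu * t) :
    |deriv f x₀ - deriv u x₀| ≤ h / 2 * (Mu + M) := by
  have hfd : Differentiable ℝ f := hf.differentiable (by norm_num)
  have hud : Differentiable ℝ u := hu.differentiable (by norm_num)
  have := fem_aux_slope (fun t => f (x₀ + σ * t) - u (x₀ + σ * t))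
    (fun t => σ * (deriv f (x₀ + σ * t) - deriv u (x₀ + σ * t))) h (Mu + M) hh ?_ ?_
    (by simp [h0]) (by simp [h1])
  · simpa [abs_mul, hσ] using this
  · intro t
    have hl : HasDerivAt (fun t => x₀ + σ * t) σ t := by
      simpa using ((hasDerivAt_id t).const_mul σ).const_add x₀
    have e := ((hfd (x₀ + σ * t)).hasDerivAt.comp t hl).sub
      ((hud (x₀ + σ * t)).hasDerivAt.comp t hl)
    exact e.congr_deriv (by ring)
  · intro t ht
    rw [← mul_sub, abs_mul, hσ, one_mul]
    have a := abs_le.1 (hM t ht)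
    have b := abs_le.1 (hMu t ht)
    simp only [mul_zero, add_zero]
    rw [abs_le]
    constructor <;> nlinarith [a.1, a.2, b.1, b.2]

theorem fem_aux_bdd (f : ℝ → ℝ) (hf : Continuous f) (a b : ℝ) :
    ∃ B, 0 ≤ B ∧ ∀ s ∈ Set.Icc a b, |f s| ≤ B := by
  obtain ⟨C, hC⟩ := isCompact_Icc.exists_bound_of_continuousOn (s := Set.Icc a b) hf.continuousOn
  exact ⟨max C 0, le_max_right _ _, fun s hs => (hC s hs).trans (le_max_left _ _)⟩

/-- Local Lipschitz bound of the interpolant. -/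
theorem fem_aux_lip (ue f₁ f₂ : ℝ → ℝ) (x₀ R B : ℝ) (hR : 0 ≤ R) (hB : 0 ≤ B)
    (hf₁ : Differentiable ℝ f₁) (hf₂ : Differentiable ℝ f₂)
    (hue₁ : ∀ s, s ≤ x₀ → ue s = f₁ s) (hue₂ : ∀ s, x₀ ≤ s → ue s = f₂ s)
    (hB₁ : ∀ s ∈ Set.Icc (x₀ - R) (x₀ + R), |deriv f₁ s| ≤ B)
    (hB₂ : ∀ s ∈ Set.Icc (x₀ - R) (x₀ + R), |deriv f₂ s| ≤ B)
    (a b : ℝ) (ha : a ∈ Set.Icc (x₀ - R) (x₀ + R)) (hb : b ∈ Set.Icc (x₀ - R) (x₀ + R)) :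
    |ue a - ue b| ≤ 2 * B * |a - b| := by
  have key : ∀ s, ue s = f₁ (min s x₀) + f₂ (max s x₀) - f₁ x₀ := by
    intro s
    have e : f₁ x₀ = f₂ x₀ := by rw [← hue₁ x₀ le_rfl, ← hue₂ x₀ le_rfl]
    rcases le_total s x₀ with h | h
    · rw [min_eq_left h, max_eq_right h, hue₁ s h, e]; ring
    · rw [min_eq_right h, max_eq_left h, hue₂ s h]; ring
  have lip : ∀ f : ℝ → ℝ, Differentiable ℝ f →
      (∀ s ∈ Set.Icc (x₀ - R) (x₀ + R), |deriv f s| ≤ B) →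
      ∀ s ∈ Set.Icc (x₀ - R) (x₀ + R), ∀ t ∈ Set.Icc (x₀ - R) (x₀ + R),
        |f s - f t| ≤ B * |s - t| := by
    intro f hf hfB s hs t ht
    exact Convex.norm_image_sub_le_of_norm_hasDerivWithin_le (f := f) (f' := deriv f)
      (fun x _ => (hf x).hasDerivAt.hasDerivWithinAt) hfB (convex_Icc _ _) ht hs
  have m : ∀ s ∈ Set.Icc (x₀ - R) (x₀ + R), min s x₀ ∈ Set.Icc (x₀ - R) (x₀ + R) := by
    intro s hs
    exact ⟨le_min hs.1 (by linarith), (min_le_left _ _).trans hs.2⟩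
  have m' : ∀ s ∈ Set.Icc (x₀ - R) (x₀ + R), max s x₀ ∈ Set.Icc (x₀ - R) (x₀ + R) := by
    intro s hs
    exact ⟨hs.1.trans (le_max_left _ _), max_le hs.2 (by linarith)⟩
  have l1 := lip f₁ hf₁ hB₁ _ (m a ha) _ (m b hb)
  have l2 := lip f₂ hf₂ hB₂ _ (m' a ha) _ (m' b hb)
  have n1 : |min a x₀ - min b x₀| ≤ |a - b| := by
    have := abs_min_sub_min_le_max a x₀ b x₀
    simpa using this
  have n2 := abs_max_sub_max_le_abs a b x₀
  have n3 := mul_le_mul_of_nonneg_left n1 hB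
  have n4 := mul_le_mul_of_nonneg_left n2 hB
  rw [key a, key b]
  have : f₁ (min a x₀) + f₂ (max a x₀) - f₁ x₀ - (f₁ (min b x₀) + f₂ (max b x₀) - f₁ x₀)
    = (f₁ (min a x₀) - f₁ (min b x₀)) + (f₂ (max a x₀) - f₂ (max b x₀)) := by ring
  rw [this]
  refine (abs_add_le _ _).trans ?_
  linarith

theorem fem_aux_deriv (G Δ : ℝ → ℝ) (hGpos : ∀ y, 0 ≤ G y)
    (hGint : Integrable G) (hΔ : Differentiable ℝ Δ) (hΔpos : ∀ x, 0 < Δ x)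
    (x₀ : ℝ) (ue f₁ f₂ : ℝ → ℝ) (hue : Continuous ue)
    (hf₁ : ContDiff ℝ 2 f₁) (hf₂ : ContDiff ℝ 2 f₂)
    (hue₁ : ∀ s, s ≤ x₀ → ue s = f₁ s) (hue₂ : ∀ s, x₀ ≤ s → ue s = f₂ s)
    (w : ℝ → ℝ) (hw : w = fun y => if x₀ - y * Δ x₀ < x₀ then deriv f₁ (x₀ - y * Δ x₀)
                 else deriv f₂ (x₀ - y * Δ x₀)) (hwm : Measurable w) :
    HasDerivAt (fun x => ∫ y in (-(1/2) : ℝ)..(1/2), G y * ue (x - y * Δ x))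
      (∫ y in (-(1/2) : ℝ)..(1/2), G y * (w y * (1 - y * deriv Δ x₀))) x₀ := by
  have hfd₁ : Differentiable ℝ f₁ := hf₁.differentiable (by norm_num)
  have hfd₂ : Differentiable ℝ f₂ := hf₂.differentiable (by norm_num)
  have hp := hΔpos x₀
  set R := Δ x₀ + 2 with hRdef
  have hR : 0 ≤ R := by linarith
  obtain ⟨B₁, hB₁0, hB₁⟩ := fem_aux_bdd (deriv f₁) (hf₁.continuous_deriv (by norm_num))
    (x₀ - R) (x₀ + R)
  obtain ⟨B₂, hB₂0, hB₂⟩ := fem_aux_bdd (deriv f₂) (hf₂.continuous_deriv (by norm_num))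
    (x₀ - R) (x₀ + R)
  have lip := fem_aux_lip ue f₁ f₂ x₀ R (B₁ + B₂) hR (by linarith) hfd₁ hfd₂ hue₁ hue₂
    (fun s hs => (hB₁ s hs).trans (by linarith)) (fun s hs => (hB₂ s hs).trans (by linarith))
  set B := B₁ + B₂ with hBdef
  have hB : 0 ≤ B := by linarith
  obtain ⟨C, hC⟩ := (hΔ x₀).hasDerivAt.isBigO_sub.bound
  have hs : {x | |Δ x - Δ x₀| ≤ C * |x - x₀| ∧ |x - x₀| < 1 ∧ Δ x < Δ x₀ + 1} ∈ nhds x₀ := by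
    have h1 : ∀ᶠ x in nhds x₀, |x - x₀| < 1 := by
      have : Continuous fun x => |x - x₀| := by fun_prop
      exact this.continuousAt.eventually_lt continuousAt_const (by simp)
    have h2 : ∀ᶠ x in nhds x₀, Δ x < Δ x₀ + 1 :=
      (hΔ x₀).continuousAt.eventually_lt continuousAt_const (by simp)
    filter_upwards [hC, h1, h2] with x a b c
    exact ⟨a, b, c⟩
  have hab : (-(1/2) : ℝ) ≤ 1/2 := by norm_num
  have hm : ∀ x, Measurable fun y => ue (x - y * Δ x) := fun x =>
    (hue.comp (by fun_prop : Continuous fun y => x - y * Δ x)).measurable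
  have main := hasFDerivAt_integral_of_dominated_loc_of_lip'
    (μ := volume.restrict (Set.Ioc (-(1/2) : ℝ) (1/2))) (𝕜 := ℝ)
    (F := fun x y => G y * ue (x - y * Δ x)) (x₀ := x₀)
    (F' := fun y => ContinuousLinearMap.toSpanSingleton ℝ (G y * (w y * (1 - y * deriv Δ x₀))))
    (bound := fun y => G y * (2 * B * (1 + C))) hs ?_ ?_ ?_ ?_ ?_ ?_
  · obtain ⟨m1, m2⟩ := main
    have e := m2.hasDerivAt
    rw [ContinuousLinearMap.integral_apply m1] at e
    simp only [intervalIntegral.integral_of_le hab]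
    simpa using e
  · intro x _
    exact hGint.aestronglyMeasurable.restrict.mul (hm x).aestronglyMeasurable
  · obtain ⟨D, _, hD⟩ := fem_aux_bdd (fun y => ue (x₀ - y * Δ x₀)) (by fun_prop) (-(1/2)) (1/2)
    refine hGint.restrict.mul_bdd (c := D) (hm x₀).aestronglyMeasurable ?_
    filter_upwards [ae_restrict_mem measurableSet_Ioc] with y hy
    exact hD y ⟨hy.1.le, hy.2⟩
  · have q : AEStronglyMeasurable (fun y => G y * (w y * (1 - y * deriv Δ x₀)))
        (volume.restrict (Set.Ioc (-(1/2) : ℝ) (1/2))) :=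
      hGint.aestronglyMeasurable.restrict.mul
        (hwm.mul (by fun_prop)).aestronglyMeasurable
    exact (ContinuousLinearMap.toSpanSingletonCLE (𝕜 := ℝ) (E := ℝ)).continuous.comp_aestronglyMeasurable q
  · filter_upwards [ae_restrict_mem measurableSet_Ioc] with y hy x hx
    obtain ⟨x1, x2, x3⟩ := hx
    have x4 := hΔpos x
    have x5 := abs_lt.1 x2
    have hyy : |y| ≤ 1/2 := abs_le.2 ⟨hy.1.le, hy.2⟩
    have p1 : ∀ z, 0 < z → z < Δ x₀ + 1 → |y * z| ≤ Δ x₀ + 1 := by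
      intro z z0 z1
      rw [abs_mul, abs_of_pos z0]
      nlinarith
    have q1 := abs_le.1 (p1 _ x4 x3)
    have q2 := abs_le.1 (p1 _ hp (by linarith))
    have l := lip (x - y * Δ x) (x₀ - y * Δ x₀)
      ⟨by linarith [q1.1, q1.2], by linarith [q1.1, q1.2]⟩
      ⟨by linarith [q2.1, q2.2], by linarith [q2.1, q2.2]⟩
    have d : |x - y * Δ x - (x₀ - y * Δ x₀)| ≤ (1 + C) * |x - x₀| := by
      have : x - y * Δ x - (x₀ - y * Δ x₀) = (x - x₀) - y * (Δ x - Δ x₀) := by ring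
      rw [this]
      refine (abs_sub _ _).trans ?_
      rw [abs_mul]
      nlinarith [abs_nonneg (Δ x - Δ x₀), abs_nonneg y]
    simp only [Real.norm_eq_abs]
    rw [← mul_sub, abs_mul, abs_of_nonneg (hGpos y), mul_assoc]
    refine mul_le_mul_of_nonneg_left (l.trans ?_) (hGpos y)
    rw [mul_assoc (2 * B)]
    exact mul_le_mul_of_nonneg_left d (by linarith)
  · exact hGint.restrict.mul_const _
  · have h0 : ∀ᵐ y ∂(volume.restrict (Set.Ioc (-(1/2) : ℝ) (1/2))), y ≠ 0 :=
      ae_restrict_of_ae (Measure.ae_ne volume 0)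
    filter_upwards [h0] with y hy
    have hin : HasDerivAt (fun x => x - y * Δ x) (1 - y * deriv Δ x₀) x₀ :=
      (hasDerivAt_id x₀).sub ((hΔ x₀).hasDerivAt.const_mul y)
    have hout : HasDerivAt ue (w y) (x₀ - y * Δ x₀) := by
      rw [hw]
      rcases lt_or_gt_of_ne hy with h | h
      · have h' : x₀ < x₀ - y * Δ x₀ := by nlinarith
        simp only [if_neg h'.not_gt]
        refine (hfd₂ _).hasDerivAt.congr_of_eventuallyEq ?_
        filter_upwards [lt_mem_nhds h'] with s hs
        exact hue₂ s hs.le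
      · have h' : x₀ - y * Δ x₀ < x₀ := by nlinarith
        simp only [if_pos h']
        refine (hfd₁ _).hasDerivAt.congr_of_eventuallyEq ?_
        filter_upwards [gt_mem_nhds h'] with s hs
        exact hue₁ s hs.le
    exact ((hout.comp x₀ hin).const_mul (G y)).hasFDerivAt

/-- The error in interchanging filtering and differentiation for a piecewise-C²
finite element interpolant `u_e` of `u` is of order `O(Δ_e · Δ′)` in the local
element widths. -/
theorem fem_interchange_bound (G Δ : ℝ → ℝ)
    (hGpos : ∀ y, 0 ≤ G y) (hGeven : ∀ y, G (-y) = G y)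
    (hGint : Integrable G)
    (hGsupp : ∀ y, y ∉ Set.Icc (-(1/2) : ℝ) (1/2) → G y = 0)
    (hΔ : Differentiable ℝ Δ) (hΔpos : ∀ x, 0 < Δ x)
    (u : ℝ → ℝ) (Mu : ℝ) (hu : ContDiff ℝ 2 u)
    (hMu : ∀ s, |iteratedDeriv 2 u s| ≤ Mu)
    (x₀ Δ₁ Δ₂ M : ℝ) (hΔ₁ : 0 < Δ₁) (hΔ₂ : 0 < Δ₂)
    (hwidth : Δ x₀ ≤ 2 * min Δ₁ Δ₂)
    (uₑ f₁ f₂ : ℝ → ℝ) (hue_cont : Continuous uₑ)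
    (hf₁ : ContDiff ℝ 2 f₁) (hf₂ : ContDiff ℝ 2 f₂)
    (hue₁ : ∀ s, s ≤ x₀ → uₑ s = f₁ s)
    (hue₂ : ∀ s, x₀ ≤ s → uₑ s = f₂ s)
    (hnode₁ : f₁ (x₀ - Δ₁) = u (x₀ - Δ₁))
    (hnode₂ : f₁ x₀ = u x₀) (hnode₃ : f₂ x₀ = u x₀)
    (hnode₄ : f₂ (x₀ + Δ₂) = u (x₀ + Δ₂))
    (hM₁ : ∀ s ∈ Set.Icc (x₀ - Δ₁) x₀, |iteratedDeriv 2 f₁ s| ≤ M)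
    (hM₂ : ∀ s ∈ Set.Icc x₀ (x₀ + Δ₂), |iteratedDeriv 2 f₂ s| ≤ M) :
    |deriv (fun x => ∫ y in (-(1/2) : ℝ)..(1/2), G y * uₑ (x - y * Δ x)) x₀
      - ∫ y in (-(1/2) : ℝ)..(1/2),
          G y * (if x₀ - y * Δ x₀ < x₀ then deriv f₁ (x₀ - y * Δ x₀)
                 else deriv f₂ (x₀ - y * Δ x₀))| ≤
    |deriv Δ x₀| *
      (((Δ₁ + Δ₂) / 2) * (Mu + M) * (∫ y in (0 : ℝ)..(1/2), y * G y)
        + Δ x₀ * M * ∫ y in (-(1/2) : ℝ)..(1/2), y ^ 2 * G y) := by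
  have hΔ₁w : Δ x₀ ≤ 2 * Δ₁ := hwidth.trans (by linarith [min_le_left Δ₁ Δ₂])
  have hΔ₂w : Δ x₀ ≤ 2 * Δ₂ := hwidth.trans (by linarith [min_le_right Δ₁ Δ₂])
  have hp := hΔpos x₀
  have hab : (-(1/2) : ℝ) ≤ 1/2 := by norm_num
  have hc₁ : Continuous (deriv f₁) := hf₁.continuous_deriv (by norm_num)
  have hc₂ : Continuous (deriv f₂) := hf₂.continuous_deriv (by norm_num)
  -- slopes
  have L₁ : ∀ t ∈ Set.Icc 0 Δ₁, |deriv f₁ (x₀ + (-1) * t) - deriv f₁ x₀| ≤ M * t := by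
    intro t ht
    have := fem_aux_deriv_lip f₁ hf₁ _ _ M hM₁ (x₀ + (-1) * t) x₀
      ⟨by linarith [ht.2], by linarith [ht.1]⟩ ⟨by linarith, le_rfl⟩
    simpa [abs_of_nonneg ht.1] using this
  have L₂ : ∀ t ∈ Set.Icc 0 Δ₂, |deriv f₂ (x₀ + 1 * t) - deriv f₂ x₀| ≤ M * t := by
    intro t ht
    have := fem_aux_deriv_lip f₂ hf₂ _ _ M hM₂ (x₀ + 1 * t) x₀
      ⟨by linarith [ht.1], by linarith [ht.2]⟩ ⟨le_rfl, by linarith⟩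
    simpa [abs_of_nonneg ht.1] using this
  have Lu : ∀ σ : ℝ, |σ| = 1 → ∀ t, 0 ≤ t → |deriv u (x₀ + σ * t) - deriv u x₀| ≤ Mu * t := by
    intro σ hσ t ht
    have hb := abs_le.1 hσ.le
    have := fem_aux_deriv_lip u hu (x₀ - t) (x₀ + t) Mu (fun s _ => hMu s) (x₀ + σ * t) x₀
      ⟨by nlinarith [hb.1], by nlinarith [hb.2]⟩ ⟨by linarith, by linarith⟩
    simpa [abs_mul, hσ, abs_of_nonneg ht] using this
  have S₁ := fem_aux_node f₁ u hf₁ hu x₀ Δ₁ (-1) M Mu (by simp) hΔ₁ hnode₂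
    (by simpa [sub_eq_add_neg] using hnode₁) L₁ (fun t ht => Lu _ (by simp) t ht.1)
  have S₂ := fem_aux_node f₂ u hf₂ hu x₀ Δ₂ 1 M Mu (by simp) hΔ₂ hnode₃
    (by simpa using hnode₄) L₂ (fun t ht => Lu _ (by simp) t ht.1)
  have S : |deriv f₁ x₀ - deriv f₂ x₀| ≤ (Δ₁ + Δ₂) / 2 * (Mu + M) := by
    have := abs_sub_le (deriv f₁ x₀) (deriv u x₀) (deriv f₂ x₀)
    rw [abs_sub_comm (deriv u x₀)] at this
    linarith
  -- the piecewise derivative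
  obtain ⟨w, hw⟩ : ∃ w : ℝ → ℝ, w = fun y => if x₀ - y * Δ x₀ < x₀ then deriv f₁ (x₀ - y * Δ x₀)
                 else deriv f₂ (x₀ - y * Δ x₀) := ⟨_, rfl⟩
  have hwm : Measurable w := by
    rw [hw]
    refine Measurable.ite (measurableSet_lt (by fun_prop) (by fun_prop)) ?_ ?_
    · exact (hc₁.comp (by fun_prop : Continuous fun y => x₀ - y * Δ x₀)).measurable
    · exact (hc₂.comp (by fun_prop : Continuous fun y => x₀ - y * Δ x₀)).measurable
  have hD := fem_aux_deriv G Δ hGpos hGint hΔ hΔpos x₀ uₑ f₁ f₂ hue_cont hf₁ hf₂ hue₁ hue₂ w hw hwm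
  have hwfold : ∀ y, (if x₀ - y * Δ x₀ < x₀ then deriv f₁ (x₀ - y * Δ x₀)
                 else deriv f₂ (x₀ - y * Δ x₀)) = w y := fun y => by rw [hw]
  simp only [hwfold]
  rw [hD.deriv]
  obtain ⟨B₁, hB₁0, hB₁⟩ := fem_aux_bdd (deriv f₁) hc₁ (x₀ - Δ x₀) (x₀ + Δ x₀)
  obtain ⟨B₂, hB₂0, hB₂⟩ := fem_aux_bdd (deriv f₂) hc₂ (x₀ - Δ x₀) (x₀ + Δ x₀)
  have hwB : ∀ y ∈ Set.Ioc (-(1/2) : ℝ) (1/2), |w y| ≤ B₁ + B₂ := by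
    intro y hy
    have hm : x₀ - y * Δ x₀ ∈ Set.Icc (x₀ - Δ x₀) (x₀ + Δ x₀) :=
      ⟨by nlinarith [hy.2], by nlinarith [hy.1]⟩
    rw [hw]
    dsimp only
    split_ifs
    · linarith [hB₁ _ hm]
    · linarith [hB₂ _ hm]
  -- integrability of `G * bounded`
  have II : ∀ (g : ℝ → ℝ) (c : ℝ), Measurable g →
      (∀ y ∈ Set.Ioc (-(1/2) : ℝ) (1/2), |g y| ≤ c) →
      IntervalIntegrable (fun y => g y * G y) volume (-(1/2) : ℝ) (1/2) := by
    intro g c hg hb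
    rw [intervalIntegrable_iff_integrableOn_Ioc_of_le hab]
    refine hGint.restrict.bdd_mul (c := c) hg.aestronglyMeasurable ?_
    filter_upwards [ae_restrict_mem measurableSet_Ioc] with y hy
    exact hb y hy
  have hyB : ∀ y ∈ Set.Ioc (-(1/2) : ℝ) (1/2), |y| ≤ 1 := fun y hy =>
    abs_le.2 ⟨by linarith [hy.1], by linarith [hy.2]⟩
  have I1 := II w _ hwm hwB
  have I2 := II (fun y => y * w y) (1 * (B₁ + B₂)) (measurable_id.mul hwm) (by
    intro y hy
    rw [abs_mul]
    exact mul_le_mul (hyB y hy) (hwB y hy) (abs_nonneg _) zero_le_one)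
  have I3 := II (fun y => y) 1 measurable_id hyB
  have I4 := II (fun y => y ^ 2) 1 (by fun_prop) (by
    intro y hy
    rw [abs_pow]
    exact pow_le_one₀ (abs_nonneg _) (hyB y hy))
  obtain ⟨st, hst⟩ : ∃ st : ℝ → ℝ, st = fun y => if 0 < y then deriv f₁ x₀ else deriv f₂ x₀ :=
    ⟨_, rfl⟩
  have hstm : Measurable st := by
    rw [hst]
    exact Measurable.ite (measurableSet_lt measurable_const measurable_id)
      measurable_const measurable_const
  have I5 := II (fun y => y * st y) (|deriv f₁ x₀| + |deriv f₂ x₀|) (measurable_id.mul hstm) (by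
    intro y hy
    rw [abs_mul]
    have : |st y| ≤ |deriv f₁ x₀| + |deriv f₂ x₀| := by
      rw [hst]
      dsimp only
      split_ifs
      · linarith [abs_nonneg (deriv f₂ x₀)]
      · linarith [abs_nonneg (deriv f₁ x₀)]
    have := mul_le_mul (hyB y hy) this (abs_nonneg _) zero_le_one
    linarith)
  have E1 : (∫ y in (-(1/2) : ℝ)..(1/2), G y * (w y * (1 - y * deriv Δ x₀)))
      - (∫ y in (-(1/2) : ℝ)..(1/2), G y * w y)
      = - deriv Δ x₀ * ∫ y in (-(1/2) : ℝ)..(1/2), y * w y * G y := by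
    have a : ∀ y, G y * (w y * (1 - y * deriv Δ x₀))
        = w y * G y - deriv Δ x₀ * (y * w y * G y) := fun y => by ring
    have b : ∀ y, G y * w y = w y * G y := fun y => mul_comm _ _
    simp only [a, b]
    rw [intervalIntegral.integral_sub I1 (I2.const_mul _), intervalIntegral.integral_const_mul]
    ring
  rw [E1, abs_mul, abs_neg]
  refine mul_le_mul_of_nonneg_left ?_ (abs_nonneg _)
  have hsub1 : Set.uIcc (-(1/2) : ℝ) 0 ⊆ Set.uIcc (-(1/2) : ℝ) (1/2) := by
    rw [Set.uIcc_of_le (by norm_num), Set.uIcc_of_le hab]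
    exact Set.Icc_subset_Icc le_rfl (by norm_num)
  have hsub2 : Set.uIcc (0 : ℝ) (1/2) ⊆ Set.uIcc (-(1/2) : ℝ) (1/2) := by
    rw [Set.uIcc_of_le (by norm_num), Set.uIcc_of_le hab]
    exact Set.Icc_subset_Icc (by norm_num) le_rfl
  have E2 : (∫ y in (-(1/2) : ℝ)..(1/2), y * st y * G y)
      = (deriv f₁ x₀ - deriv f₂ x₀) * ∫ y in (0 : ℝ)..(1/2), y * G y := by
    rw [← intervalIntegral.integral_add_adjacent_intervals (I5.mono_set hsub1) (I5.mono_set hsub2)]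
    have e1 : (∫ y in (-(1/2) : ℝ)..0, y * st y * G y)
        = ∫ y in (-(1/2) : ℝ)..0, deriv f₂ x₀ * (y * G y) := by
      refine intervalIntegral.integral_congr fun y hy => ?_
      rw [Set.uIcc_of_le (by norm_num)] at hy
      simp only [hst, if_neg hy.2.not_gt]
      ring
    have e2 : (∫ y in (0 : ℝ)..(1/2), y * st y * G y)
        = ∫ y in (0 : ℝ)..(1/2), deriv f₁ x₀ * (y * G y) := by
      refine intervalIntegral.integral_congr fun y hy => ?_
      rw [Set.uIcc_of_le (by norm_num)] at hy
      rcases hy.1.eq_or_lt with h | h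
      · simp [← h]
      · simp only [hst, if_pos h]
        ring
    have e3 : (∫ y in (-(1/2) : ℝ)..0, y * G y) = - ∫ y in (0 : ℝ)..(1/2), y * G y := by
      have := intervalIntegral.integral_comp_neg (a := 0) (b := 1/2) (fun y => y * G y)
      simp only [hGeven, neg_mul, intervalIntegral.integral_neg, neg_zero] at this
      exact this.symm
    rw [e1, e2, intervalIntegral.integral_const_mul, intervalIntegral.integral_const_mul, e3]
    ring
  have E3 : |∫ y in (-(1/2) : ℝ)..(1/2), (y * w y * G y - y * st y * G y)|
      ≤ ∫ y in (-(1/2) : ℝ)..(1/2), Δ x₀ * M * (y ^ 2 * G y) := by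
    refine intervalIntegral.norm_integral_le_of_norm_le (E := ℝ) hab (Filter.Eventually.of_forall ?_)
      (I4.const_mul _)
    intro y hy
    have hdiff : |w y - st y| ≤ M * (|y| * Δ x₀) := by
      rcases lt_or_ge 0 y with h | h
      · have h' : x₀ - y * Δ x₀ < x₀ := by nlinarith
        simp only [hw, hst, if_pos h, if_pos h']
        have := L₁ (y * Δ x₀) ⟨by positivity, by nlinarith [hy.2]⟩
        rw [abs_of_pos h]
        convert this using 4
        ring
      · have h' : ¬ x₀ - y * Δ x₀ < x₀ := by nlinarith
        simp only [hw, hst, if_neg h.not_gt, if_neg h']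
        have := L₂ (-y * Δ x₀) ⟨by nlinarith, by nlinarith [hy.1]⟩
        rw [abs_of_nonpos h]
        convert this using 4
        ring
    have : y * w y * G y - y * st y * G y = (y * (w y - st y)) * G y := by ring
    rw [this, Real.norm_eq_abs, abs_mul, abs_mul, abs_of_nonneg (hGpos y), ← mul_assoc]
    refine mul_le_mul_of_nonneg_right ?_ (hGpos y)
    have := mul_le_mul_of_nonneg_left hdiff (abs_nonneg y)
    refine this.trans (le_of_eq ?_)
    rw [← sq_abs y]
    ring
  rw [intervalIntegral.integral_sub I2 I5, intervalIntegral.integral_const_mul, E2] at E3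
  have K0 : 0 ≤ ∫ y in (0 : ℝ)..(1/2), y * G y :=
    intervalIntegral.integral_nonneg (by norm_num) fun y hy => mul_nonneg hy.1 (hGpos y)
  have E4 := mul_le_mul_of_nonneg_right S K0
  rw [← abs_of_nonneg K0, ← abs_mul, abs_of_nonneg K0] at E4
  have E5 := abs_add_le ((∫ y in (-(1/2) : ℝ)..(1/2), y * w y * G y)
    - (deriv f₁ x₀ - deriv f₂ x₀) * ∫ y in (0 : ℝ)..(1/2), y * G y)
    ((deriv f₁ x₀ - deriv f₂ x₀) * ∫ y in (0 : ℝ)..(1/2), y * G y)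
  rw [sub_add_cancel] at E5
  linarith
end
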